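/- Let n ≥ 2 and α ∈ (0, 2/n). There exists a constant c > 0 depending only on n and α such that for all ε > 0, R > 0 and T > 0, writing Ψ(x,t) = C_α ( T / (|x|² + R² (t+T)^{4/(2−nα)}) )^{1/α} with C_α^α = 2 n^{α−1} (2/α − n), there exists a family of smooth functions ū_1^ε, …, ū_{2n}^ε defined on the region S = { (x,t) : (|x|² + R² (t+T)^{4/(2−nα)})^{1/2} < (c/ε) T, 0 ≤ t < T } that is a classical subsolution of the scaled Carleman kinetic system with interaction k_α on S and satisfies (1/(4n)) Ψ ≤ ū_i^ε ≤ (3/(4n)) Ψ on S for every i = 1,…,2n. -/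

import Mathlib

/-- The `2n` velocities: `v_i = e_i` for the first copy of `Fin n` and
`v_{i+n} = −e_i` for the second copy. -/
noncomputable def vel {n : ℕ} : (Fin n ⊕ Fin n) → EuclideanSpace ℝ (Fin n) :=
  Sum.elim (fun i => EuclideanSpace.single i (1 : ℝ))
    (fun i => -EuclideanSpace.single i (1 : ℝ))

noncomputable section

/-- The quadratic velocity profile that makes the second order terms of the kinetic system
isotropic. -/
def carlemanProfile (α s : ℝ) : ℝ := 1 + s + (1 - α / 2) * s ^ 2

end

theorem abs_carlemanProfile_sub_one_le {α s r : ℝ} (hα0 : 0 < α) (hα1 : α < 1)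
    (hs : |s| ≤ r) (hr : r ≤ 1 / 4) : |carlemanProfile α s - 1| ≤ 2 * r := by
  have h0 : 0 ≤ r := (abs_nonneg s).trans hs
  have h2 : s ^ 2 ≤ r ^ 2 := sq_le_sq' (abs_le.mp hs).1 (abs_le.mp hs).2
  obtain ⟨h3, h4⟩ := abs_le.mp hs
  have h5 : (1 - α / 2) * s ^ 2 ≤ r ^ 2 := by nlinarith [sq_nonneg s]
  have h6 : 0 ≤ (1 - α / 2) * s ^ 2 := mul_nonneg (by linarith) (sq_nonneg s)
  rw [carlemanProfile, abs_le]
  constructor <;> nlinarith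

theorem hasDerivAt_carlemanProfile (α s : ℝ) :
    HasDerivAt (carlemanProfile α) (1 + (2 - α) * s) s := by
  have h := ((hasDerivAt_id s).const_add 1).add (((hasDerivAt_id s).pow 2).const_mul (1 - α / 2))
  refine (h.congr_deriv ?_).congr_of_eventuallyEq (.of_forall fun y => by
    simp [carlemanProfile])
  simp
  ring

theorem contDiff_carlemanProfile (α : ℝ) {k : WithTop ℕ∞} :
    ContDiff ℝ k (carlemanProfile α) := by
  unfold carlemanProfile
  fun_prop

/-- A second order lower bound complementing Bernoulli's inequality for exponents in `(0, 1)`. -/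
theorem one_add_mul_sub_sq_le_rpow {α m : ℝ} (hα0 : 0 < α) (hα1 : α < 1) (hm : -1 / 2 ≤ m) :
    1 + α * m - m ^ 2 ≤ (1 + m) ^ α := by
  have hpos : 0 < 1 + m := by linarith
  have h1 : (1 + m) ^ (1 - α) ≤ 1 + (1 - α) * m :=
    rpow_one_add_le_one_add_mul_self (by linarith) (by linarith) (by linarith)
  have h2 : (1 + m) ^ α * (1 + m) ^ (1 - α) = 1 + m := by
    rw [← Real.rpow_add hpos]; simp
  have h3 : 0 < (1 + m) ^ α := Real.rpow_pos_of_pos hpos _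
  have h4 : 0 < 1 + (1 - α) * m := by nlinarith
  have h5 : 1 + m ≤ (1 + m) ^ α * (1 + (1 - α) * m) := by
    nlinarith [mul_le_mul_of_nonneg_left h1 h3.le]
  refine le_of_mul_le_mul_right (h5.trans' ?_) h4
  have h6 : 0 ≤ 1 - α * (1 - α) + (1 - α) * m := by nlinarith
  nlinarith [mul_nonneg (sq_nonneg m) h6]

theorem abs_one_add_rpow_sub_le {α m : ℝ} (hα0 : 0 < α) (hα1 : α < 1) (hm : -1 / 2 ≤ m) :
    |(1 + m) ^ α - (1 + α * m)| ≤ m ^ 2 := by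
  have h1 := one_add_mul_sub_sq_le_rpow hα0 hα1 hm
  have h2 : (1 + m) ^ α ≤ 1 + α * m :=
    rpow_one_add_le_one_add_mul_self (by linarith) (by linarith) (by linarith)
  rw [abs_le]
  constructor <;> nlinarith [sq_nonneg m]

/-- Third order expansion of the Carleman interaction between two profile values. -/
theorem le_carleman_interaction {α s s' r : ℝ} (hα0 : 0 < α) (hα1 : α < 1)
    (hs : |s| ≤ r) (hs' : |s'| ≤ r) (hr : r ≤ 1 / 4) :
    s' - s + (s' ^ 2 - s ^ 2) - 12 * r ^ 3 ≤
      ((carlemanProfile α s + carlemanProfile α s') / 2) ^ α *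
        (carlemanProfile α s' - carlemanProfile α s) := by
  have h0 : 0 ≤ r := (abs_nonneg s).trans hs
  have hsq : s ^ 2 ≤ r ^ 2 := sq_le_sq' (abs_le.mp hs).1 (abs_le.mp hs).2
  have hsq' : s' ^ 2 ≤ r ^ 2 := sq_le_sq' (abs_le.mp hs').1 (abs_le.mp hs').2
  obtain ⟨a, ha⟩ : ∃ a, a = 1 - α / 2 := ⟨_, rfl⟩
  have ha0 : 0 < a := by linarith
  have ha1 : a < 1 := by linarith
  obtain ⟨Q, hQ⟩ : ∃ Q, Q = a * ((s ^ 2 + s' ^ 2) / 2) := ⟨_, rfl⟩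
  have hQ0 : 0 ≤ Q := by rw [hQ]; positivity
  have hQr : Q ≤ r ^ 2 := by
    rw [hQ]; nlinarith [sq_nonneg s, sq_nonneg s']
  obtain ⟨σ, hσ⟩ : ∃ σ, σ = s + s' := ⟨_, rfl⟩
  have hσr : |σ| ≤ 2 * r := by
    rw [hσ]; exact (abs_add_le _ _).trans (by linarith)
  obtain ⟨m, hm⟩ : ∃ m, m = σ / 2 + Q := ⟨_, rfl⟩
  have hmr : |m| ≤ 5 / 4 * r := by
    rw [abs_le] at hσr ⊢
    constructor <;> nlinarith
  have hmean : (carlemanProfile α s + carlemanProfile α s') / 2 = 1 + m := by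
    rw [hm, hQ, hσ, carlemanProfile, carlemanProfile, ha]; ring
  have hdiff : carlemanProfile α s' - carlemanProfile α s = (s' - s) * (1 + a * σ) := by
    rw [hσ, carlemanProfile, carlemanProfile, ha]; ring
  rw [hmean, hdiff]
  have hE := abs_one_add_rpow_sub_le hα0 hα1 (m := m) (by linarith [(abs_le.mp hmr).1])
  obtain ⟨E, hEdef⟩ : ∃ E, E = (1 + m) ^ α - (1 + α * m) := ⟨_, rfl⟩
  rw [← hEdef] at hE
  have hpow : (1 + m) ^ α = 1 + α * m + E := by linarith
  have hm2 : m ^ 2 ≤ 25 / 16 * r ^ 2 := by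
    have := sq_le_sq' (abs_le.mp hmr).1 (abs_le.mp hmr).2
    nlinarith
  have haσ : |a * σ| ≤ 2 * r := by
    rw [abs_mul, abs_of_pos ha0]; nlinarith [abs_nonneg σ]
  have hαQ : |α * Q| ≤ r ^ 2 := by
    rw [abs_of_nonneg (by positivity)]; nlinarith
  have hαm : |α * m| ≤ 5 / 4 * r := by
    rw [abs_mul, abs_of_pos hα0]; nlinarith [abs_nonneg m]
  have hprod : |α * m * (a * σ)| ≤ 5 / 2 * r ^ 2 := by
    rw [abs_mul]
    exact (mul_le_mul hαm haσ (abs_nonneg _) (by positivity)).trans (le_of_eq (by ring))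
  have hfac : |1 + a * σ| ≤ 3 / 2 := by
    rw [abs_le] at haσ ⊢
    constructor <;> linarith
  have hEfac : |E * (1 + a * σ)| ≤ 5 / 2 * r ^ 2 := by
    rw [abs_mul]
    refine (mul_le_mul (hE.trans hm2) hfac (abs_nonneg _) (by positivity)).trans ?_
    linarith [sq_nonneg r]
  obtain ⟨B, hB⟩ : ∃ B, B = α * Q + α * m * (a * σ) + E * (1 + a * σ) := ⟨_, rfl⟩
  have hBr : |B| ≤ 6 * r ^ 2 := by
    rw [hB]
    exact ((abs_add_le _ _).trans (add_le_add_left (abs_add_le _ _) _)).trans (by linarith)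
  have hd : |s' - s| ≤ 2 * r := (abs_sub _ _).trans (by linarith)
  have hprodB : |(s' - s) * B| ≤ 12 * r ^ 3 := by
    rw [abs_mul]
    exact (mul_le_mul hd hBr (abs_nonneg _) (by positivity)).trans (le_of_eq (by ring))
  have hid : (1 + m) ^ α * ((s' - s) * (1 + a * σ)) =
      s' - s + (s' ^ 2 - s ^ 2) + (s' - s) * B := by
    rw [hpow, hB]
    have h1 : (s' - s) * σ = s' ^ 2 - s ^ 2 := by rw [hσ]; ring
    rw [← h1, hm, ha]; ring
  rw [hid]
  linarith [(abs_le.mp hprodB).1]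

/-- The kinetic inequality in dimensionless form: `r` bounds the scaled velocity components
`s j`, `A` is the scaled logarithmic time derivative, and `1 - q` is the scaled `‖x‖ ^ 2`. -/
theorem carleman_scaled_inequality {ι : Type*} [Fintype ι] {N α r q A : ℝ} {s : ι → ℝ}
    (hN : 2 ≤ N) (hcard : (Fintype.card ι : ℝ) = 2 * N) (hα0 : 0 < α) (hα1 : α < 1)
    (hγ : 0 < 2 - N * α) (hr0 : 0 < r) (hr : r * (40 * N) ≤ 2 - N * α)
    (hs : ∀ j, |s j| ≤ r) (hsum : ∑ j, s j = 0)
    (hsq : ∑ j, s j ^ 2 = 2 * r ^ 2 * (1 - q))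
    (hA : A ≤ -(2 * q / (α * (2 - N * α)))) (hA' : -(4 / (α * (2 - N * α))) ≤ A) (hA0 : A ≤ 0)
    (i : ι) :
    A * carlemanProfile α (s i) + N / (2 - N * α) * (1 + (2 - α) * s i) -
      2 * (N / (2 - N * α)) / (α * r ^ 2) * (s i * carlemanProfile α (s i) + 1 / (2 * N) *
        ∑ j, ((carlemanProfile α (s i) + carlemanProfile α (s j)) / 2) ^ α *
          (carlemanProfile α (s j) - carlemanProfile α (s i))) ≤ 0 := by
  have hr4 : r ≤ 1 / 4 := by nlinarith
  have hsi := hs i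
  have hcoll : r ^ 2 * (1 - q) / N - s i - s i ^ 2 - 12 * r ^ 3 ≤ 1 / (2 * N) *
        ∑ j, ((carlemanProfile α (s i) + carlemanProfile α (s j)) / 2) ^ α *
          (carlemanProfile α (s j) - carlemanProfile α (s i)) := by
    have h := Finset.sum_le_sum fun j (_ : j ∈ Finset.univ) =>
      le_carleman_interaction hα0 hα1 hsi (hs j) hr4
    simp only [Finset.sum_sub_distrib, Finset.sum_add_distrib, hsum, hsq, Finset.sum_const,
      Finset.card_univ, nsmul_eq_mul, hcard] at h
    refine (mul_le_mul_of_nonneg_left h (by positivity : (0 : ℝ) ≤ 1 / (2 * N))).trans' ?_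
    apply le_of_eq
    field_simp
    ring
  set K := 1 / (2 * N) *
        ∑ j, ((carlemanProfile α (s i) + carlemanProfile α (s j)) / 2) ^ α *
          (carlemanProfile α (s j) - carlemanProfile α (s i))
  clear_value K
  have hcube : -r ^ 3 ≤ (1 - α / 2) * s i ^ 3 := by
    have h1 : |s i| ^ 3 ≤ r ^ 3 := pow_le_pow_left₀ (abs_nonneg _) hsi 3
    have h2 : |(1 - α / 2) * s i ^ 3| ≤ r ^ 3 := by
      rw [abs_mul, abs_pow, abs_of_pos (by linarith)]
      nlinarith [pow_nonneg (abs_nonneg (s i)) 3]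
    exact (abs_le.mp h2).1
  have hbr : r ^ 2 * ((1 - q) / N - 13 * r) ≤ s i * carlemanProfile α (s i) + K := by
    have h1 : s i * carlemanProfile α (s i) = s i + s i ^ 2 + (1 - α / 2) * s i ^ 3 := by
      unfold carlemanProfile; ring
    rw [h1]
    have h2 : r ^ 2 * ((1 - q) / N - 13 * r) = r ^ 2 * (1 - q) / N - 13 * r ^ 3 := by ring
    rw [h2]
    linarith
  have hlast : 2 * N / (α * (2 - N * α)) * ((1 - q) / N - 13 * r) ≤
      2 * (N / (2 - N * α)) / (α * r ^ 2) * (s i * carlemanProfile α (s i) + K) := by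
    refine (mul_le_mul_of_nonneg_left hbr (by positivity)).trans' (le_of_eq ?_)
    field_simp
  have hg := (abs_le.mp (abs_carlemanProfile_sub_one_le hα0 hα1 hsi hr4)).1
  have hAg : A * carlemanProfile α (s i) ≤ A + 4 / (α * (2 - N * α)) * (2 * r) := by
    nlinarith
  have hκ : N / (2 - N * α) * (1 + (2 - α) * s i) ≤ N / (2 - N * α) * (1 + 2 * r) := by
    have h1 : (2 - α) * s i ≤ 2 * r := by nlinarith [abs_le.mp hsi, le_abs_self (s i)]
    gcongr
  have hfin : -(2 * q / (α * (2 - N * α))) + 4 / (α * (2 - N * α)) * (2 * r) +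
      N / (2 - N * α) * (1 + 2 * r) -
      2 * N / (α * (2 - N * α)) * ((1 - q) / N - 13 * r) ≤ 0 := by
    have h1 : -(2 * q / (α * (2 - N * α))) + 4 / (α * (2 - N * α)) * (2 * r) +
      N / (2 - N * α) * (1 + 2 * r) -
      2 * N / (α * (2 - N * α)) * ((1 - q) / N - 13 * r) =
      (r * (8 + 2 * (N * α) + 26 * N) - (2 - N * α)) / (α * (2 - N * α)) := by
      field_simp
      ring
    rw [h1]
    apply div_nonpos_of_nonpos_of_nonneg _ (by positivity)
    nlinarith
  linarith

theorem norm_vel {n : ℕ} (i : Fin n ⊕ Fin n) : ‖vel i‖ = 1 := by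
  rcases i with i | i <;> simp [vel]

theorem sum_inner_vel {n : ℕ} (x : EuclideanSpace ℝ (Fin n)) :
    ∑ i, inner ℝ (vel i) x = 0 := by
  simp [vel, Fintype.sum_sum_type]

theorem sum_inner_vel_sq {n : ℕ} (x : EuclideanSpace ℝ (Fin n)) :
    ∑ i, inner ℝ (vel i) x ^ 2 = 2 * ‖x‖ ^ 2 := by
  simp [vel, Fintype.sum_sum_type, EuclideanSpace.real_norm_sq_eq, EuclideanSpace.inner_single_left,
    two_mul]

theorem hasDerivAt_barenblatt_profile {C T α D : ℝ} (hT : 0 < T) (hD : 0 < D) :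
    HasDerivAt (fun d => C * (T / d) ^ (1 / α))
      (-(1 / α) * (C * (T / D) ^ (1 / α)) / D) D := by
  have h := (((hasDerivAt_const D T).div (hasDerivAt_id D) hD.ne').rpow_const (p := 1 / α)
    (Or.inl (div_pos hT hD).ne')).const_mul C
  refine h.congr_deriv ?_
  simp only [id, Pi.div_apply]
  rw [Real.rpow_sub_one (div_pos hT hD).ne']
  field_simp
  ring

theorem deriv_kinetic_barrier {C T α R β b t G : ℝ} (hT : 0 < T) (ht : 0 ≤ t) (hR : 0 < R)
    (hb : 0 ≤ b) :
    deriv (fun s => C * (T / (b + R ^ 2 * (s + T) ^ β)) ^ (1 / α) * G) t =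
      -(1 / α) * (C * (T / (b + R ^ 2 * (t + T) ^ β)) ^ (1 / α)) /
        (b + R ^ 2 * (t + T) ^ β) * (R ^ 2 * (β * (t + T) ^ (β - 1))) * G := by
  have hτ : 0 < t + T := by linarith
  have hD : 0 < b + R ^ 2 * (t + T) ^ β := by positivity
  have h1 : HasDerivAt (fun s => b + R ^ 2 * (s + T) ^ β)
      (R ^ 2 * (β * (t + T) ^ (β - 1))) t := by
    have h := ((((hasDerivAt_id t).add_const T).rpow_const (p := β)
      (Or.inl hτ.ne')).const_mul (R ^ 2)).const_add b
    refine h.congr_deriv ?_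
    simp
  exact (((hasDerivAt_barenblatt_profile (C := C) (α := α) hT hD).comp t h1).mul_const G).deriv

theorem fderiv_kinetic_barrier {E : Type*} [NormedAddCommGroup E] [InnerProductSpace ℝ E]
    {C T α b k M : ℝ} (hT : 0 < T) (hb : 0 < b) (v x : E) (hv : ‖v‖ = 1) :
    fderiv ℝ (fun y => C * (T / (‖y‖ ^ 2 + b)) ^ (1 / α) *
        (carlemanProfile α (k * inner ℝ v y) / M)) x v =
      C * (T / (‖x‖ ^ 2 + b)) ^ (1 / α) / M *
        ((1 + (2 - α) * (k * inner ℝ v x)) * k -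
          2 / α * (inner ℝ v x / (‖x‖ ^ 2 + b)) * carlemanProfile α (k * inner ℝ v x)) := by
  have hD : 0 < ‖x‖ ^ 2 + b := by positivity
  have h1 : HasFDerivAt (fun y : E => ‖y‖ ^ 2 + b) (2 • innerSL ℝ x) x :=
    (hasStrictFDerivAt_norm_sq x).hasFDerivAt.add_const b
  have h2 : HasFDerivAt (fun y : E => k * inner ℝ v y) (k • innerSL ℝ v) x :=
    (innerSL ℝ v).hasFDerivAt.const_mul k
  have h3 := (hasDerivAt_barenblatt_profile (C := C) (α := α) hT hD).comp_hasFDerivAt x h1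
  have h4 := ((hasDerivAt_carlemanProfile α (k * inner ℝ v x)).div_const M).comp_hasFDerivAt x h2
  have h5 := (h3.mul h4).fderiv
  refine (congrArg (fun L => L v) h5).trans ?_
  simp [hv, real_inner_comm v x]
  ring

theorem carleman_interaction_homogeneous {P N α a b : ℝ} (hP : 0 < P) (hN : 0 < N)
    (hab : 0 ≤ a + b) :
    (P * (a / (2 * N)) + P * (b / (2 * N))) ^ α * (P * (b / (2 * N)) - P * (a / (2 * N))) =
      (P / N) ^ α * (P / (2 * N)) * (((a + b) / 2) ^ α * (b - a)) := by
  have h : P * (a / (2 * N)) + P * (b / (2 * N)) = P / N * ((a + b) / 2) := by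
    field_simp
  rw [h, Real.mul_rpow (by positivity) (by positivity)]
  ring

theorem barenblatt_div_rpow {C T D N α : ℝ} (hC : 0 < C) (hT : 0 < T) (hD : 0 < D) (hN : 0 < N)
    (hα : 0 < α) (hCα : C ^ α = 2 * N ^ (α - 1) * (2 / α - N)) :
    (C * (T / D) ^ (1 / α) / N) ^ α = 2 * (2 - N * α) * T / (N * α * D) := by
  rw [Real.div_rpow (by positivity) hN.le, Real.mul_rpow hC.le (by positivity),
    ← Real.rpow_mul (by positivity), one_div_mul_cancel hα.ne', Real.rpow_one, hCα,
    Real.rpow_sub_one hN.ne']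
  have : N ^ α ≠ 0 := (Real.rpow_pos_of_pos hN α).ne'
  field_simp

theorem contDiffOn_kinetic_barrier {E : Type*} [NormedAddCommGroup E] [InnerProductSpace ℝ E]
    {C T α R β k M : ℝ} (hT : 0 < T) (hR : 0 < R) (v : E) {S : Set (E × ℝ)}
    (hS : ∀ p ∈ S, 0 ≤ p.2) {m : WithTop ℕ∞} :
    ContDiffOn ℝ m (fun p : E × ℝ => C * (T / (‖p.1‖ ^ 2 + R ^ 2 * (p.2 + T) ^ β)) ^ (1 / α) *
      (carlemanProfile α (k * inner ℝ v p.1) / M)) S := by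
  intro p hp
  have hτ : 0 < p.2 + T := by linarith [hS p hp]
  have hD : 0 < ‖p.1‖ ^ 2 + R ^ 2 * (p.2 + T) ^ β := by positivity
  have h1 : ContDiffAt ℝ m (fun p : E × ℝ => ‖p.1‖ ^ 2 + R ^ 2 * (p.2 + T) ^ β) p :=
    (contDiff_fst.norm_sq ℝ).contDiffAt.add
      (contDiffAt_const.mul ((contDiffAt_snd.add contDiffAt_const).rpow_const_of_ne hτ.ne'))
  have h2 : ContDiffAt ℝ m (fun p : E × ℝ => carlemanProfile α (k * inner ℝ v p.1) / M) p :=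
    ((contDiff_carlemanProfile α).comp
      (contDiff_const.mul (contDiff_const.inner ℝ contDiff_fst))).contDiffAt.div_const M
  exact ((contDiffAt_const.mul ((contDiffAt_const.div h1 hD.ne').rpow_const_of_ne
    (div_pos hT hD).ne')).mul h2).contDiffWithinAt

/-- Existence of a family of local smooth subsolutions in the supercritical
range `α ∈ (0, 2/n)`, `n ≥ 2`: there is a constant `c > 0` depending only on
`n, α` such that for all `ε, R, T > 0`, writing
`Ψ(x,t) = C_α (T/(|x|²+R²(t+T)^{4/(2−nα)}))^{1/α}` with
`C_α^α = 2n^{α−1}(2/α − n)`, there is a family `ū_1^ε, …, ū_{2n}^ε`, smooth on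
`S = {(x,t) : (|x|²+R²(t+T)^{4/(2−nα)})^{1/2} < (c/ε)T, 0 ≤ t < T}`, which is
a classical subsolution of the scaled Carleman system with interaction `k_α`
on `S` and satisfies `(1/(4n))Ψ ≤ ū_i^ε ≤ (3/(4n))Ψ` on `S`. -/
theorem exists_local_subsolution_family_supercritical (n : ℕ) (hn : 2 ≤ n)
    (α : ℝ) (hα : 0 < α ∧ α < 2 / (n : ℝ)) :
    ∃ c > (0 : ℝ), ∀ (ε R T : ℝ), 0 < ε → 0 < R → 0 < T →
      ∀ Cα : ℝ, 0 < Cα →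
      Cα ^ α = 2 * (n : ℝ) ^ (α - 1) * (2 / α - (n : ℝ)) →
      ∀ Ψ : EuclideanSpace ℝ (Fin n) → ℝ → ℝ,
      (∀ x s, Ψ x s = Cα *
        (T / (‖x‖ ^ 2 + R ^ 2 * (s + T) ^ (4 / (2 - n * α)))) ^ (1 / α)) →
      ∃ u : (Fin n ⊕ Fin n) → EuclideanSpace ℝ (Fin n) → ℝ → ℝ,
        (∀ i, ContDiffOn ℝ (⊤ : ℕ∞) (fun p : EuclideanSpace ℝ (Fin n) × ℝ => u i p.1 p.2)
          {p : EuclideanSpace ℝ (Fin n) × ℝ |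
            (‖p.1‖ ^ 2 + R ^ 2 * (p.2 + T) ^ (4 / (2 - n * α))) ^ ((1 : ℝ) / 2) <
              (c / ε) * T ∧ 0 ≤ p.2 ∧ p.2 < T}) ∧
        ∀ (x : EuclideanSpace ℝ (Fin n)) (t : ℝ),
          (‖x‖ ^ 2 + R ^ 2 * (t + T) ^ (4 / (2 - n * α))) ^ ((1 : ℝ) / 2) <
            (c / ε) * T → 0 ≤ t → t < T → ∀ i,
            (deriv (fun s => u i x s) t +
              (1 / ε) * fderiv ℝ (fun y => u i y t) x (vel i) -
              (1 / (2 * (n : ℝ) * ε ^ 2)) *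
                ∑ j, (u i x t + u j x t) ^ α * (u j x t - u i x t) ≤ 0) ∧
            (1 / (4 * (n : ℝ))) * Ψ x t ≤ u i x t ∧
            u i x t ≤ (3 / (4 * (n : ℝ))) * Ψ x t := by
  obtain ⟨hα0, hα2⟩ := hα
  obtain ⟨N, hNdef⟩ : ∃ N : ℝ, N = n := ⟨_, rfl⟩
  have hN : 2 ≤ N := by rw [hNdef]; exact_mod_cast hn
  rw [← hNdef] at hα2 ⊢
  have hγ : 0 < 2 - N * α := by
    rw [lt_div_iff₀ (by linarith)] at hα2
    linarith
  have hα1 : α < 1 := by nlinarith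
  obtain ⟨κ, hκ⟩ : ∃ κ, κ = N / (2 - N * α) := ⟨_, rfl⟩
  have hκ0 : 0 < κ := by rw [hκ]; positivity
  refine ⟨(2 - N * α) ^ 2 / (40 * N ^ 2), by positivity, ?_⟩
  intro ε R T hε hR hT C hC hCα Ψ hΨ
  obtain ⟨β, hβ⟩ : ∃ β, β = 4 / (2 - N * α) := ⟨_, rfl⟩
  obtain ⟨k, hk⟩ : ∃ k, k = ε * κ / T := ⟨_, rfl⟩
  have hk0 : 0 < k := by rw [hk]; positivity
  simp only [← hβ] at hΨ ⊢
  refine ⟨fun i x s => C * (T / (‖x‖ ^ 2 + R ^ 2 * (s + T) ^ β)) ^ (1 / α) *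
    (carlemanProfile α (k * inner ℝ (vel i) x) / (2 * N)),
    fun i => contDiffOn_kinetic_barrier hT hR (vel i) fun p hp => hp.2.1, ?_⟩
  intro x t hxt ht0 htT i
  have hτ : 0 < t + T := by linarith
  have hD : 0 < ‖x‖ ^ 2 + R ^ 2 * (t + T) ^ β := by positivity
  have hdt := deriv_kinetic_barrier (C := C) (α := α) (β := β)
    (G := carlemanProfile α (k * inner ℝ (vel i) x) / (2 * N)) hT ht0 hR (sq_nonneg ‖x‖)
  have hdx := fderiv_kinetic_barrier (C := C) (α := α) (k := k) (M := 2 * N)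
    (b := R ^ 2 * (t + T) ^ β) hT (by positivity) (vel i) x (norm_vel i)
  rw [hdt, hdx, hΨ]
  clear hdt hdx hΨ
  obtain ⟨D, hDdef⟩ : ∃ D, D = ‖x‖ ^ 2 + R ^ 2 * (t + T) ^ β := ⟨_, rfl⟩
  simp only [← hDdef] at hxt hD ⊢
  have hPα := barenblatt_div_rpow hC hT hD (by linarith : 0 < N) hα0 hCα
  have hP : 0 < C * (T / D) ^ (1 / α) := by positivity
  generalize C * (T / D) ^ (1 / α) = P at *
  obtain ⟨r, hr⟩ : ∃ r, r = k * √D := ⟨_, rfl⟩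
  have hr0 : 0 < r := by rw [hr]; positivity
  have hr2 : r ^ 2 = k ^ 2 * D := by rw [hr, mul_pow, Real.sq_sqrt hD.le]
  have hrN : r * (40 * N) ≤ 2 - N * α := by
    rw [← Real.sqrt_eq_rpow] at hxt
    have h1 : r ≤ k * ((2 - N * α) ^ 2 / (40 * N ^ 2) / ε * T) := by
      rw [hr]; gcongr
    have h2 : k * ((2 - N * α) ^ 2 / (40 * N ^ 2) / ε * T) * (40 * N) = 2 - N * α := by
      rw [hk, hκ]; field_simp
    nlinarith
  have hxD : ‖x‖ ≤ √D := Real.le_sqrt_of_sq_le (by rw [hDdef]; simp; positivity)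
  have hs : ∀ j, |k * inner ℝ (vel j) x| ≤ r := fun j => by
    rw [hr, abs_mul, abs_of_pos hk0]
    gcongr
    exact (abs_real_inner_le_norm _ _).trans (by rw [norm_vel, one_mul]; exact hxD)
  have hr4 : r ≤ 1 / 4 := by nlinarith
  have hg := fun j => abs_le.mp (abs_carlemanProfile_sub_one_le hα0 hα1 (hs j) hr4)
  refine ⟨?_, ?_, ?_⟩
  · have hτβ : (t + T) ^ (β - 1) = (t + T) ^ β / (t + T) := Real.rpow_sub_one hτ.ne' β
    have hcore := carleman_scaled_inequality (ι := Fin n ⊕ Fin n) (N := N) (α := α) (r := r)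
      (q := R ^ 2 * (t + T) ^ β / D)
      (A := -(4 / (α * (2 - N * α)) * (R ^ 2 * (t + T) ^ β / D) * (T / (t + T))))
      (s := fun j => k * inner ℝ (vel j) x) hN (by simp [hNdef, two_mul]) hα0 hα1 hγ hr0 hrN hs
      (by rw [← Finset.mul_sum, sum_inner_vel, mul_zero])
      (by
        simp only [mul_pow]
        rw [← Finset.mul_sum, sum_inner_vel_sq, hr2]
        field_simp
        rw [hDdef]; ring)
      (by
        have h1 : 1 / 2 ≤ T / (t + T) := by
          rw [div_le_div_iff₀ (by norm_num) hτ]; linarith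
        have h2 := mul_le_mul_of_nonneg_left h1
          (by positivity : 0 ≤ 4 / (α * (2 - N * α)) * (R ^ 2 * (t + T) ^ β / D))
        refine (neg_le_neg h2).trans (le_of_eq ?_)
        ring)
      (by
        have h1 : T / (t + T) ≤ 1 := (div_le_one hτ).mpr (by linarith)
        have h2 : R ^ 2 * (t + T) ^ β / D ≤ 1 :=
          (div_le_one hD).mpr (by rw [hDdef]; nlinarith [sq_nonneg ‖x‖])
        rw [mul_assoc]
        exact neg_le_neg (mul_le_of_le_one_right (by positivity)
          (mul_le_one₀ h2 (by positivity) h1)))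
      (neg_nonpos.mpr (by positivity)) i
    have hsum : ∑ j, (P * (carlemanProfile α (k * inner ℝ (vel i) x) / (2 * N)) +
          P * (carlemanProfile α (k * inner ℝ (vel j) x) / (2 * N))) ^ α *
          (P * (carlemanProfile α (k * inner ℝ (vel j) x) / (2 * N)) -
            P * (carlemanProfile α (k * inner ℝ (vel i) x) / (2 * N))) =
        (P / N) ^ α * (P / (2 * N)) * ∑ j, ((carlemanProfile α (k * inner ℝ (vel i) x) +
          carlemanProfile α (k * inner ℝ (vel j) x)) / 2) ^ α *
          (carlemanProfile α (k * inner ℝ (vel j) x) -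
            carlemanProfile α (k * inner ℝ (vel i) x)) := by
      rw [Finset.mul_sum]
      refine Finset.sum_congr rfl fun j _ => ?_
      exact carleman_interaction_homogeneous hP (by linarith)
        (by linarith [(hg i).1, (hg j).1])
    rw [hsum, hPα, hτβ]
    refine (le_of_eq ?_).trans
      (mul_nonpos_of_nonneg_of_nonpos (by positivity : 0 ≤ P / (2 * N * T)) hcore)
    rw [hr2]
    generalize (∑ j, ((carlemanProfile α (k * inner ℝ (vel i) x) +
          carlemanProfile α (k * inner ℝ (vel j) x)) / 2) ^ α *
          (carlemanProfile α (k * inner ℝ (vel j) x) -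
            carlemanProfile α (k * inner ℝ (vel i) x))) = K
    generalize carlemanProfile α (k * inner ℝ (vel i) x) = g
    generalize inner ℝ (vel i) x = p
    generalize (t + T) ^ β = Y
    rw [hβ, hk, hκ]
    have hγ' := hγ.ne'
    generalize 2 - N * α = γ at hγ' ⊢
    clear * - hγ' hα0 hε hT hD hτ hN
    have hN0 : N ≠ 0 := by linarith
    field_simp
    ring
  · have h1 : 1 / (4 * N) * P = P * (1 / 2 / (2 * N)) := by ring
    rw [h1]
    gcongr
    linarith [(hg i).1]
  · have h1 : 3 / (4 * N) * P = P * (3 / 2 / (2 * N)) := by ring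
    rw [h1]
    gcongr
    linarith [(hg i).2]
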